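/- arXiv:2202.05553 — 4 statements merged into one kernel-verified Lean document; each statement's English description precedes it below -/
import Mathlib

section
/- Let X and A be finite nonempty types, let d ≥ 1, and let σ : X → A → Matrix (Fin d) (Fin d) ℂ be a family of matrices. Then σ is a non-signalling assemblage (each σ x a is positive semidefinite, ∑_a σ x a = ∑_a σ x' a for all x, x', and trace(∑_a σ x a) = 1 for all x) if and only if σ admits a quantum realisation, i.e. there exist n ≥ 1, a positive semidefinite ρ : Matrix (Fin n × Fin d) (Fin n × Fin d) ℂ with trace 1, and matrices M : X → A → Matrix (Fin n) (Fin n) ℂ with each M x a positive semidefinite and ∑_a M x a = 1 for every x, such that σ x a = ptr₁((M x a ⊗ₖ 1) * ρ) for all x, a. -/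
open scoped Kronecker ComplexOrder

/-- Partial trace over the first tensor factor. -/
noncomputable def ptr1 {n d : ℕ} (M : Matrix (Fin n × Fin d) (Fin n × Fin d) ℂ) :
    Matrix (Fin d) (Fin d) ℂ :=
  Matrix.of fun i j => ∑ k : Fin n, M (k, i) (k, j)

open Matrix

open scoped MatrixOrder in
lemma Matrix.PosSemidef.exists_eq_conjTranspose_mul_self {m : Type*} [Fintype m]
    {T : Matrix m m ℂ} (hT : T.PosSemidef) : ∃ B : Matrix m m ℂ, T = Bᴴ * B := by
  classical
  exact CStarAlgebra.nonneg_iff_eq_star_mul_self.mp hT.nonneg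

lemma ptr1_eq_sum_submatrix {n d : ℕ} (M : Matrix (Fin n × Fin d) (Fin n × Fin d) ℂ) :
    ptr1 M = ∑ k : Fin n, M.submatrix (fun i => (k, i)) (fun i => (k, i)) := by
  ext i j
  simp [ptr1, Matrix.sum_apply]

lemma ptr1_sum {n d : ℕ} {ι : Type*} (s : Finset ι)
    (M : ι → Matrix (Fin n × Fin d) (Fin n × Fin d) ℂ) :
    ptr1 (∑ a ∈ s, M a) = ∑ a ∈ s, ptr1 (M a) := by
  ext i j
  simp only [ptr1, Matrix.of_apply, Matrix.sum_apply]
  exact Finset.sum_comm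

lemma trace_ptr1 {n d : ℕ} (M : Matrix (Fin n × Fin d) (Fin n × Fin d) ℂ) :
    (ptr1 M).trace = M.trace := by
  simp only [ptr1, Matrix.trace, Matrix.diag, Matrix.of_apply, Fintype.sum_prod_type]
  exact Finset.sum_comm

lemma Matrix.PosSemidef.ptr1 {n d : ℕ} {M : Matrix (Fin n × Fin d) (Fin n × Fin d) ℂ}
    (hM : M.PosSemidef) : (ptr1 M).PosSemidef := by
  rw [ptr1_eq_sum_submatrix]
  exact posSemidef_sum _ fun k _ => hM.submatrix _

/-- Operators on the traced-out factor can be cycled under the partial trace. -/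
lemma ptr1_kronecker_one_mul_comm {n d : ℕ} (B : Matrix (Fin n) (Fin n) ℂ)
    (M : Matrix (Fin n × Fin d) (Fin n × Fin d) ℂ) :
    ptr1 ((B ⊗ₖ (1 : Matrix (Fin d) (Fin d) ℂ)) * M) =
      ptr1 (M * (B ⊗ₖ (1 : Matrix (Fin d) (Fin d) ℂ))) := by
  ext i j
  simp only [ptr1, Matrix.of_apply, Matrix.mul_apply, Fintype.sum_prod_type,
    Matrix.kroneckerMap_apply, Matrix.one_apply, mul_ite, ite_mul, mul_one, mul_zero, zero_mul,
    Finset.sum_ite_eq, Finset.sum_ite_eq', Finset.mem_univ, if_true]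
  rw [Finset.sum_comm]
  exact Finset.sum_congr rfl fun _ _ => Finset.sum_congr rfl fun _ _ => mul_comm _ _

lemma Matrix.PosSemidef.ptr1_kronecker_one_mul {n d : ℕ} {E : Matrix (Fin n) (Fin n) ℂ}
    {ρ : Matrix (Fin n × Fin d) (Fin n × Fin d) ℂ} (hE : E.PosSemidef) (hρ : ρ.PosSemidef) :
    (_root_.ptr1 ((E ⊗ₖ (1 : Matrix (Fin d) (Fin d) ℂ)) * ρ)).PosSemidef := by
  obtain ⟨B, rfl⟩ := hE.exists_eq_conjTranspose_mul_self
  have h : (Bᴴ * B) ⊗ₖ (1 : Matrix (Fin d) (Fin d) ℂ) =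
      (Bᴴ ⊗ₖ (1 : Matrix (Fin d) (Fin d) ℂ)) * (B ⊗ₖ 1) := by
    rw [← mul_kronecker_mul, one_mul]
  have h' : Bᴴ ⊗ₖ (1 : Matrix (Fin d) (Fin d) ℂ) = (B ⊗ₖ (1 : Matrix (Fin d) (Fin d) ℂ))ᴴ := by
    rw [conjTranspose_kronecker, conjTranspose_one]
  rw [h, Matrix.mul_assoc, ptr1_kronecker_one_mul_comm, h']
  exact (hρ.mul_mul_conjTranspose_same _).ptr1

/-- Measuring the purification with amplitudes `R` steers to `R * Eᵀ * Rᴴ`. -/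
lemma ptr1_kronecker_one_mul_vecMulVec {n d : ℕ} (E : Matrix (Fin n) (Fin n) ℂ)
    (R : Matrix (Fin d) (Fin n) ℂ) :
    ptr1 ((E ⊗ₖ (1 : Matrix (Fin d) (Fin d) ℂ)) *
      vecMulVec (fun p => R p.2 p.1) (star fun p : Fin n × Fin d => R p.2 p.1)) =
      R * Eᵀ * Rᴴ := by
  ext i j
  simp only [ptr1, Matrix.of_apply, Matrix.mul_apply, Fintype.sum_prod_type, vecMulVec_apply,
    Matrix.kroneckerMap_apply, Matrix.one_apply, mul_ite, ite_mul, mul_one, mul_zero, zero_mul,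
    Finset.sum_ite_eq, Finset.mem_univ, if_true, Matrix.transpose_apply,
    Matrix.conjTranspose_apply, Finset.sum_mul, Pi.star_apply]
  exact Finset.sum_congr rfl fun _ _ => Finset.sum_congr rfl fun _ _ => by ring

/-- A positive semidefinite matrix has a factor `R` with a left pseudo-inverse `P`. -/
lemma Matrix.PosSemidef.exists_factor_pseudoinverse {m : Type*} [Fintype m] [DecidableEq m]
    {S : Matrix m m ℂ} (hS : S.PosSemidef) :
    ∃ R P : Matrix m m ℂ, S = R * Rᴴ ∧ R * (P * R) = R ∧
      (P * R) * (P * R)ᴴ = P * R ∧ (1 - P * R).PosSemidef := by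
  set U : Matrix m m ℂ := hS.1.eigenvectorUnitary.1
  set s : m → ℂ := fun i => (Real.sqrt (hS.1.eigenvalues i) : ℂ) with hs
  have hUU : Uᴴ * U = 1 := (Matrix.mem_unitaryGroup_iff').mp hS.1.eigenvectorUnitary.2
  have hss : star s = s := by ext i; simp [hs]
  have hPR : diagonal (s⁻¹) * Uᴴ * (U * diagonal s) = diagonal (fun i => (s i)⁻¹ * s i) := by
    rw [Matrix.mul_assoc, ← Matrix.mul_assoc Uᴴ, hUU, Matrix.one_mul, diagonal_mul_diagonal]
    rfl
  refine ⟨U * diagonal s, diagonal (s⁻¹) * Uᴴ, ?_, ?_, ?_, ?_⟩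
  · conv_lhs => rw [hS.1.spectral_theorem]
    rw [conjTranspose_mul, diagonal_conjTranspose, hss, Matrix.mul_assoc,
      ← Matrix.mul_assoc (diagonal s), diagonal_mul_diagonal]
    rw [Unitary.conjStarAlgAut_apply, Matrix.mul_assoc]
    congr 3
    ext i
    simp only [hs, Function.comp, ← Complex.ofReal_mul,
      Real.mul_self_sqrt (hS.eigenvalues_nonneg i)]
    rfl
  · rw [hPR, Matrix.mul_assoc, diagonal_mul_diagonal]
    simp only [← mul_assoc, mul_inv_mul_cancel]
  · rw [hPR, diagonal_conjTranspose, diagonal_mul_diagonal]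
    congr 1
    ext i
    by_cases h : s i = 0 <;> simp [h]
  · rw [hPR, ← diagonal_one, diagonal_sub, posSemidef_diagonal_iff]
    intro i
    by_cases h : s i = 0 <;> simp [h]

lemma Matrix.PosSemidef.mul_eq_zero_of_mul_mul_conjTranspose {m : Type*} [Fintype m]
    {T K : Matrix m m ℂ} (hT : T.PosSemidef) (h : K * T * Kᴴ = 0) :
    K * T = 0 := by
  obtain ⟨B, rfl⟩ := hT.exists_eq_conjTranspose_mul_self
  have h0 : K * Bᴴ * (K * Bᴴ)ᴴ = 0 := by
    simpa [conjTranspose_mul, Matrix.mul_assoc] using h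
  rw [← Matrix.mul_assoc, self_mul_conjTranspose_eq_zero.mp h0, Matrix.zero_mul]

/-- A matrix annihilating a sum of positive semidefinite matrices annihilates each summand. -/
lemma Matrix.PosSemidef.mul_eq_zero_of_mul_sum_eq_zero {m A : Type*} [Fintype m]
    [Fintype A] {T : A → Matrix m m ℂ} {K : Matrix m m ℂ} (hT : ∀ a, (T a).PosSemidef)
    (h : K * ∑ a, T a = 0) (a : A) : K * T a = 0 := by
  apply (hT a).mul_eq_zero_of_mul_mul_conjTranspose
  have hp : ∀ b, (K * T b * Kᴴ).PosSemidef := fun b => (hT b).mul_mul_conjTranspose_same K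
  have hsum : ∑ b, (K * T b * Kᴴ).trace = 0 := by
    rw [← trace_sum, ← Matrix.sum_mul, ← Matrix.mul_sum, h, Matrix.zero_mul, trace_zero]
  have h0 := (Finset.sum_eq_zero_iff_of_nonneg fun b _ => (hp b).trace_nonneg).mp hsum a
    (Finset.mem_univ a)
  exact (hp a).trace_eq_zero_iff.mp h0

/-- GHJW theorem: a bipartite assemblage is non-signalling iff it admits a quantum
realisation. -/
theorem ghjw_nonsignalling_iff_quantum
    {X A : Type} [Fintype X] [Nonempty X] [Fintype A] [Nonempty A]
    {d : ℕ} (hd : 1 ≤ d) (σ : X → A → Matrix (Fin d) (Fin d) ℂ) :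
    ((∀ x a, (σ x a).PosSemidef) ∧
      (∀ x x', ∑ a : A, σ x a = ∑ a : A, σ x' a) ∧
      (∀ x, (∑ a : A, σ x a).trace = 1))
    ↔
    (∃ (n : ℕ), 1 ≤ n ∧
      ∃ (ρ : Matrix (Fin n × Fin d) (Fin n × Fin d) ℂ),
        ρ.PosSemidef ∧ ρ.trace = 1 ∧
        ∃ (M : X → A → Matrix (Fin n) (Fin n) ℂ),
          (∀ x a, (M x a).PosSemidef) ∧
          (∀ x, ∑ a : A, M x a = 1) ∧
          (∀ x a, σ x a = ptr1 ((M x a ⊗ₖ (1 : Matrix (Fin d) (Fin d) ℂ)) * ρ))) := by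
  constructor
  · rintro ⟨hpos, hns, htr⟩
    obtain ⟨x₀⟩ := ‹Nonempty X›
    obtain ⟨R, P, hS, hRPR, hQ, hQpos⟩ :=
      (posSemidef_sum Finset.univ fun a _ => hpos x₀ a).exists_factor_pseudoinverse
    have hS' : ∀ x, ∑ a, σ x a = R * Rᴴ := fun x => (hns x x₀).trans hS
    have hsupp : ∀ x a, R * P * σ x a = σ x a := by
      intro x a
      have h : (1 - R * P) * ∑ a, σ x a = 0 := by
        rw [hS', Matrix.sub_mul, Matrix.one_mul, ← Matrix.mul_assoc, Matrix.mul_assoc R P R, hRPR,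
          sub_self]
      have := PosSemidef.mul_eq_zero_of_mul_sum_eq_zero (hpos x) h a
      rw [Matrix.sub_mul, Matrix.one_mul, sub_eq_zero] at this
      exact this.symm
    have hsupp' : ∀ x a, σ x a * (R * P)ᴴ = σ x a := by
      intro x a
      have := congrArg conjTranspose (hsupp x a)
      rwa [conjTranspose_mul, (hpos x a).1.eq] at this
    set c : ℂ := (Fintype.card A : ℂ)⁻¹ with hc
    have hc0 : 0 ≤ c := by
      rw [hc]
      exact inv_nonneg.mpr (Nat.cast_nonneg _)
    have hcA : (Fintype.card A : ℂ) * c = 1 :=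
      mul_inv_cancel₀ (Nat.cast_ne_zero.mpr Fintype.card_ne_zero)
    refine ⟨d, hd, vecMulVec (fun p => R p.2 p.1) (star fun p : Fin d × Fin d => R p.2 p.1),
      posSemidef_vecMulVec_self_star _, ?_,
      fun x a => (P * σ x a * Pᴴ + c • (1 - P * R))ᵀ, ?_, ?_, ?_⟩
    · have h := ptr1_kronecker_one_mul_vecMulVec (1 : Matrix (Fin d) (Fin d) ℂ) R
      rw [one_kronecker_one, Matrix.one_mul, transpose_one, Matrix.mul_one] at h
      rw [← trace_ptr1, h, ← hS' x₀, htr]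
    · intro x a
      exact (((hpos x a).mul_mul_conjTranspose_same P).add (hQpos.smul hc0)).transpose
    · intro x
      have h : P * (R * Rᴴ) * Pᴴ = P * R := by
        rw [← Matrix.mul_assoc, Matrix.mul_assoc (P * R), ← conjTranspose_mul, hQ]
      rw [← transpose_sum, Finset.sum_add_distrib, ← Matrix.sum_mul, ← Matrix.mul_sum, hS', h,
        Finset.sum_const, Finset.card_univ, ← Nat.cast_smul_eq_nsmul ℂ, smul_smul, hcA, one_smul,
        add_sub_cancel, transpose_one]
    · intro x a
      have h₁ : R * (P * σ x a * Pᴴ) * Rᴴ = σ x a := by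
        calc R * (P * σ x a * Pᴴ) * Rᴴ = R * P * σ x a * (R * P)ᴴ := by
              simp only [conjTranspose_mul, Matrix.mul_assoc]
          _ = σ x a := by rw [hsupp, hsupp']
      have h₂ : R * (1 - P * R) = 0 := by
        rw [Matrix.mul_sub, Matrix.mul_one, hRPR, sub_self]
      rw [ptr1_kronecker_one_mul_vecMulVec, transpose_transpose, Matrix.mul_add, Matrix.add_mul,
        h₁, Matrix.mul_smul, h₂, smul_zero, Matrix.zero_mul, add_zero]
  · rintro ⟨n, -, ρ, hρ, htr, M, hM, hsum, hσ⟩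
    have hmarg : ∀ x, ∑ a, σ x a = ptr1 ρ := by
      intro x
      have hk : ∑ a, M x a ⊗ₖ (1 : Matrix (Fin d) (Fin d) ℂ) = 1 := by
        rw [← one_kronecker_one, ← hsum x]
        ext i j
        simp [Matrix.sum_apply, Finset.sum_mul]
      simp only [hσ]
      rw [← ptr1_sum, ← Matrix.sum_mul, hk, Matrix.one_mul]
    refine ⟨fun x a => ?_, fun x x' => ?_, fun x => ?_⟩
    · rw [hσ]
      exact (hM x a).ptr1_kronecker_one_mul hρ
    · rw [hmarg, hmarg]
    · rw [hmarg, trace_ptr1, htr]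
end

section
/- Let X and A be finite nonempty types, let d ≥ 1, and let σ : X → A → Matrix (Fin d) (Fin d) ℂ be a non-signalling assemblage (each σ x a is positive semidefinite, ∑_a σ x a = ∑_a σ x' a for all x, x', and trace(∑_a σ x a) = 1 for all x); write σ_R := ∑_a σ x₀ a for some fixed x₀. Then there exists a positive semidefinite matrix Γ : Matrix ((Option (A × X)) × Fin d) ((Option (A × X)) × Fin d) ℂ such that, writing Γ[v,w] for the d × d block with entries Γ[v,w] i j = Γ (v,i) (w,j): (i) Γ[none, none] = σ_R; (ii) Γ[none, some (a,x)] = σ x a and Γ[some (a,x), none] = σ x a for all a, x; (iii) Γ[some (a,x), some (a,x)] = σ x a for all a, x; (iv) Γ[some (a,x), some (a',x)] = 0 whenever a ≠ a'. -/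
open scoped ComplexOrder

namespace Matrix

/-- The Moore–Penrose inverse of a positive semidefinite matrix exists, and is positive
semidefinite. -/
theorem PosSemidef.exists_pseudoinverse {n : Type*} [Fintype n] [DecidableEq n]
    {R : Matrix n n ℂ} (hR : R.PosSemidef) :
    ∃ P : Matrix n n ℂ, P.PosSemidef ∧ R * P * R = R ∧ P * R * P = P := by
  have hU := Unitary.coe_star_mul_self hR.isHermitian.eigenvectorUnitary
  have hspec := hR.isHermitian.spectral_theorem
  rw [Unitary.conjStarAlgAut_apply] at hspec
  set U : Matrix n n ℂ := (hR.isHermitian.eigenvectorUnitary : Matrix n n ℂ)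
  set l := hR.isHermitian.eigenvalues
  have hconj (D E : Matrix n n ℂ) : U * D * star U * (U * E * star U) = U * (D * E) * star U := by
    calc _ = U * D * (star U * U) * E * star U := by simp only [mul_assoc]
      _ = _ := by rw [hU]; simp only [mul_one, mul_assoc]
  refine ⟨U * diagonal (fun i => ((l i)⁻¹ : ℂ)) * star U, ?_, ?_, ?_⟩
  · refine PosSemidef.mul_mul_conjTranspose_same (PosSemidef.diagonal fun i => ?_) U
    have h := hR.eigenvalues_nonneg i
    change (0 : ℂ) ≤ ((l i : ℂ))⁻¹
    exact_mod_cast inv_nonneg.2 h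
  · conv_lhs => rw [hspec]
    conv_rhs => rw [hspec]
    rw [hconj, hconj, diagonal_mul_diagonal, diagonal_mul_diagonal]
    congr 3
    ext i
    by_cases h : l i = 0 <;> simp [h]
  · conv_lhs => rw [hspec]
    rw [hconj, hconj, diagonal_mul_diagonal, diagonal_mul_diagonal]
    congr 3
    ext i
    by_cases h : l i = 0 <;> simp [h]

open scoped MatrixOrder in
theorem PosSemidef.exists_eq_conjTranspose_mul_self_s1 {n : Type*} [Fintype n]
    {M : Matrix n n ℂ} (hM : M.PosSemidef) : ∃ S : Matrix n n ℂ, M = Sᴴ * S := by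
  classical
  exact CStarAlgebra.nonneg_iff_eq_star_mul_self.1 hM.nonneg

theorem PosSemidef.mul_eq_zero_of_sum_mul_eq_zero {n ι : Type*} [Fintype n] [Fintype ι]
    {σ : ι → Matrix n n ℂ} (hσ : ∀ a, (σ a).PosSemidef) {N : Matrix n n ℂ}
    (hN : N * ∑ a, σ a = 0) (a : ι) : N * σ a = 0 := by
  classical
  have hpsd (c : ι) : (N * σ c * Nᴴ).PosSemidef := (hσ c).mul_mul_conjTranspose_same N
  have hsum : ∑ c, (N * σ c * Nᴴ).trace = 0 := by
    rw [← trace_sum, ← Finset.sum_mul, ← Finset.mul_sum, hN, Matrix.zero_mul, trace_zero]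
  have htr := (Finset.sum_eq_zero_iff_of_nonneg fun c _ => (hpsd c).trace_nonneg).1 hsum a
    (Finset.mem_univ a)
  have hzero := (hpsd a).trace_eq_zero_iff.1 htr
  obtain ⟨S, hS⟩ := exists_eq_conjTranspose_mul_self_s1 (hσ a)
  rw [hS, ← Matrix.mul_assoc, Matrix.mul_assoc] at hzero
  have hNS : N * Sᴴ = 0 := by
    rw [← self_mul_conjTranspose_eq_zero, conjTranspose_mul, conjTranspose_conjTranspose]
    exact hzero
  rw [hS, ← Matrix.mul_assoc, hNS, Matrix.zero_mul]

/-- The row of blocks `B v`, as a single matrix. -/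
def blockRow {m n V : Type*} (B : V → Matrix m n ℂ) : Matrix m (V × n) ℂ :=
  of fun i p => B p.1 i p.2

theorem conjTranspose_blockRow_mul_mul_apply {m n V : Type*} [Fintype m]
    (B C : V → Matrix m n ℂ) (M : Matrix m m ℂ) (v w : V) (i j : n) :
    ((blockRow B)ᴴ * M * blockRow C) (v, i) (w, j) = ((B v)ᴴ * M * C w) i j := rfl

/-- With `E a = √R⁺ σ a √R⁺` a POVM on the support of `R = ∑ a, σ a`, this exhibits the covariance
`δ E a - E a E b` as a sum of congruences of the `σ c`. -/
theorem sum_conjTranspose_mul_mul_eq_sub {n A : Type*} [Fintype n] [DecidableEq n] [Fintype A]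
    [DecidableEq A] {σ : A → Matrix n n ℂ} (hσ : ∀ a, (σ a).IsHermitian)
    {P : Matrix n n ℂ} (hP : P.IsHermitian) (hPRP : P * (∑ a, σ a) * P = P) (a b : A) :
    ∑ c, ((if c = a then 1 else 0) - P * σ a)ᴴ * σ c * ((if c = b then 1 else 0) - P * σ b) =
      (if a = b then σ a else 0) - σ a * P * σ b := by
  have hterm (c : A) :
      ((if c = a then 1 else 0) - P * σ a)ᴴ * σ c * ((if c = b then 1 else 0) - P * σ b) =
        (if c = a then (if c = b then σ c else 0) else 0) - (if c = a then σ c * P * σ b else 0)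
          - (if c = b then σ a * P * σ c else 0) + σ a * (P * σ c * P) * σ b := by
    rw [conjTranspose_sub, conjTranspose_mul, (hσ a).eq, hP.eq]
    split_ifs <;> simp <;> noncomm_ring
  simp_rw [hterm, Finset.sum_add_distrib, Finset.sum_sub_distrib, ← Finset.sum_mul,
    ← Finset.mul_sum, ← Finset.sum_mul, ← Finset.mul_sum, hPRP]
  simp

end Matrix

/-- First half of the moment-matrix proof of the GHJW theorem: every non-signalling
bipartite assemblage admits an almost-quantum moment matrix. -/
theorem nonsignalling_has_almost_quantum_moment_matrix
    {X A : Type} [Fintype X] [Nonempty X] [Fintype A] [Nonempty A]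
    {d : ℕ} (hd : 1 ≤ d) (σ : X → A → Matrix (Fin d) (Fin d) ℂ)
    (hpos : ∀ x a, (σ x a).PosSemidef)
    (hns : ∀ x x', ∑ a : A, σ x a = ∑ a : A, σ x' a)
    (hnorm : ∀ x, (∑ a : A, σ x a).trace = 1)
    (x₀ : X) :
    ∃ Γ : Matrix ((Option (A × X)) × Fin d) ((Option (A × X)) × Fin d) ℂ,
      Γ.PosSemidef ∧
      (∀ i j : Fin d, Γ (none, i) (none, j) = (∑ a : A, σ x₀ a) i j) ∧
      (∀ (a : A) (x : X) (i j : Fin d),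
        Γ (none, i) (some (a, x), j) = σ x a i j ∧
        Γ (some (a, x), i) (none, j) = σ x a i j) ∧
      (∀ (a : A) (x : X) (i j : Fin d),
        Γ (some (a, x), i) (some (a, x), j) = σ x a i j) ∧
      (∀ (a a' : A) (x : X) (i j : Fin d), a ≠ a' →
        Γ (some (a, x), i) (some (a', x), j) = 0) := by
  classical
  set R := ∑ a : A, σ x₀ a
  have hsum (x : X) : ∑ a : A, σ x a = R := hns x x₀
  have hRpos : R.PosSemidef := Matrix.posSemidef_sum _ fun a _ => hpos x₀ a
  obtain ⟨P, hP, hRPR, hPRP⟩ := hRpos.exists_pseudoinverse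
  have hRPσ (x : X) (a : A) : R * P * σ x a = σ x a := by
    have h := Matrix.PosSemidef.mul_eq_zero_of_sum_mul_eq_zero (hpos x) (N := 1 - R * P)
      (by rw [hsum, sub_mul, hRPR, one_mul, sub_self]) a
    rw [sub_mul, one_mul, sub_eq_zero] at h
    exact h.symm
  have hσPR (x : X) (a : A) : σ x a * P * R = σ x a := by
    have h := congrArg Matrix.conjTranspose (hRPσ x a)
    simpa [Matrix.conjTranspose_mul, (hpos x a).isHermitian.eq, hP.isHermitian.eq,
      hRpos.isHermitian.eq, mul_assoc] using h
  let B : Option (A × X) → Matrix (Fin d) (Fin d) ℂ := fun v => v.elim R fun p => σ p.2 p.1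
  let F (x : X) (c : A) : Option (A × X) → Matrix (Fin d) (Fin d) ℂ := fun v =>
    v.elim 0 fun p => if p.2 = x then (if c = p.1 then 1 else 0) - P * σ p.2 p.1 else 0
  let G (v w : Option (A × X)) : Matrix (Fin d) (Fin d) ℂ :=
    (B v).conjTranspose * P * B w + ∑ x, ∑ c, (F x c v).conjTranspose * σ x c * F x c w
  let Γ := (Matrix.blockRow B).conjTranspose * P * Matrix.blockRow B +
    ∑ x, ∑ c, (Matrix.blockRow (F x c)).conjTranspose * σ x c * Matrix.blockRow (F x c)
  have hΓ (v w : Option (A × X)) (i j : Fin d) : Γ (v, i) (w, j) = G v w i j := by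
    simp only [Γ, G, Matrix.add_apply, Matrix.sum_apply,
      Matrix.conjTranspose_blockRow_mul_mul_apply]
  have hG (a a' : A) (x : X) :
      G (some (a, x)) (some (a', x)) = if a = a' then σ x a else 0 := by
    have hF : ∑ y, ∑ c, (F y c (some (a, x))).conjTranspose * σ y c * F y c (some (a', x)) =
        ∑ c, (F x c (some (a, x))).conjTranspose * σ x c * F x c (some (a', x)) :=
      Fintype.sum_eq_single x fun y hy => by simp [F, hy.symm]
    have h := Matrix.sum_conjTranspose_mul_mul_eq_sub (fun a => (hpos x a).isHermitian)
      hP.isHermitian ((hsum x).symm ▸ hPRP) a a'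
    simp only [G, hF]
    simp only [F, B, Option.elim_some, if_true, h, (hpos x a).isHermitian.eq]
    abel
  refine ⟨Γ, ?_, fun i j => ?_, fun a x i j => ⟨?_, ?_⟩, fun a x i j => ?_,
    fun a a' x i j haa' => ?_⟩
  · exact (hP.conjTranspose_mul_mul_same _).add <| Matrix.posSemidef_sum _ fun x _ =>
      Matrix.posSemidef_sum _ fun c _ => (hpos x c).conjTranspose_mul_mul_same _
  · rw [hΓ]
    simp [G, B, F, hRpos.isHermitian.eq, hRPR]
  · rw [hΓ]
    simp [G, B, F, hRpos.isHermitian.eq, hRPσ]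
  · rw [hΓ]
    simp [G, B, F, (hpos x a).isHermitian.eq, hσPR]
  · rw [hΓ, hG, if_pos rfl]
  · rw [hΓ, hG, if_neg haa', Matrix.zero_apply]
end

section
/- Let n ≥ 1, let A be a finite nonempty type, and let N : A → Matrix (Fin n) (Fin n) ℂ be a POVM: each N a is positive semidefinite and ∑_a N a = 1. Then there exist m ≥ 1 and a family P : A → Matrix (Fin n × Fin m) (Fin n × Fin m) ℂ forming a complete projective measurement (each P a is Hermitian, P a * P a = P a, P a * P a' = 0 for a ≠ a', and ∑_a P a = 1) such that for all a and all i j : Fin n, N a i j = P a (i, 0) (j, 0), i.e. compressing P a to the ancilla state e₀ recovers N a. -/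
open scoped ComplexOrder

open Matrix in
/-- The Hermitian involution which exchanges the first summand with the range of the isometry `V`
and fixes the orthogonal complement of that range. -/
def isometrySwap {ι κ : Type*} [Fintype ι] [DecidableEq κ] (V : Matrix κ ι ℂ) :
    Matrix (ι ⊕ κ) (ι ⊕ κ) ℂ :=
  fromBlocks 0 Vᴴ V (1 - V * Vᴴ)

open Matrix in
theorem isometrySwap_isHermitian {ι κ : Type*} [Fintype ι] [DecidableEq κ] (V : Matrix κ ι ℂ) :
    (isometrySwap V).IsHermitian := by
  simp [isometrySwap, IsHermitian, fromBlocks_conjTranspose]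

open Matrix in
theorem isometrySwap_mul_self {ι κ : Type*} [Fintype ι] [Fintype κ] [DecidableEq ι]
    [DecidableEq κ] {V : Matrix κ ι ℂ} (hV : Vᴴ * V = 1) :
    isometrySwap V * isometrySwap V = 1 := by
  have h₁ : Vᴴ * (V * Vᴴ) = Vᴴ := by rw [← Matrix.mul_assoc, hV, Matrix.one_mul]
  have h₂ : V * Vᴴ * V = V := by rw [Matrix.mul_assoc, hV, Matrix.mul_one]
  have h₃ : V * Vᴴ * (V * Vᴴ) = V * Vᴴ := by rw [← Matrix.mul_assoc, h₂]
  rw [isometrySwap, fromBlocks_multiply, ← fromBlocks_one]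
  congr 1
  · simp [hV]
  · simp [Matrix.mul_sub, h₁]
  · simp [Matrix.sub_mul, h₂]
  · simp [Matrix.mul_sub, Matrix.sub_mul, h₃]

/-- The diagonal projection onto the basis vectors labelled `a` by `f`. -/
def fiberProj {κ A : Type*} [DecidableEq κ] [DecidableEq A] (f : κ → A) (a : A) :
    Matrix κ κ ℂ :=
  Matrix.diagonal fun k => if f k = a then 1 else 0

section fiberProj

variable {κ A : Type*} [DecidableEq κ] [DecidableEq A] (f : κ → A)

theorem fiberProj_isHermitian (a : A) : (fiberProj f a).IsHermitian :=
  Matrix.isHermitian_diagonal_of_self_adjoint _ <| by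
    ext k
    simp [apply_ite]

theorem fiberProj_mul_self [Fintype κ] (a : A) : fiberProj f a * fiberProj f a = fiberProj f a := by
  simp [fiberProj, Matrix.diagonal_mul_diagonal]

theorem fiberProj_mul_of_ne [Fintype κ] {a b : A} (h : a ≠ b) : fiberProj f a * fiberProj f b = 0 := by
  rw [fiberProj, fiberProj, Matrix.diagonal_mul_diagonal, ← Matrix.diagonal_zero]
  congr 1
  ext k
  split_ifs <;> simp_all

theorem sum_fiberProj [Fintype A] : ∑ a, fiberProj f a = 1 := by
  ext i j
  rw [Matrix.sum_apply]
  by_cases h : i = j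
  · subst h
    simp [fiberProj]
  · simp [fiberProj, h]

end fiberProj

open Matrix in
/-- Naimark dilation on the direct sum `ℂ^ι ⊕ (ℂ^ι ⊗ ℂ^A)`, with `ℂ^ι` the first summand. -/
theorem naimark_dilation_sum {ι A : Type*} [Fintype ι] [DecidableEq ι] [Fintype A]
    [DecidableEq A] [Nonempty A] (N : A → Matrix ι ι ℂ) (hpos : ∀ a, (N a).PosSemidef)
    (hsum : ∑ a, N a = 1) :
    ∃ P : A → Matrix (ι ⊕ ι × A) (ι ⊕ ι × A) ℂ,
      (∀ a, (P a).IsHermitian) ∧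
      (∀ a, P a * P a = P a) ∧
      (∀ a b, a ≠ b → P a * P b = 0) ∧
      (∑ a, P a = 1) ∧
      ∀ a, (P a).toBlocks₁₁ = N a := by
  have hroot (a : A) : ∃ B : Matrix ι ι ℂ, N a = Bᴴ * B :=
    by
    open scoped MatrixOrder in
    exact CStarAlgebra.nonneg_iff_eq_star_mul_self.mp (hpos a).nonneg
  choose B hB using hroot
  let V : Matrix (ι × A) ι ℂ := of fun p j => B p.2 p.1 j
  have hcomp (a : A) : Vᴴ * (fiberProj Prod.snd a : Matrix (ι × A) (ι × A) ℂ) * V = N a := by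
    ext i j
    rw [hB, fiberProj, mul_apply, mul_apply]
    simp [V, mul_diagonal, Fintype.sum_prod_type]
  have hV : Vᴴ * V = 1 := by
    rw [← hsum, ← Finset.sum_congr rfl fun a _ => hcomp a, ← Matrix.sum_mul, ← Matrix.mul_sum,
      sum_fiberProj, Matrix.mul_one]
  let a₀ : A := Classical.arbitrary A
  let f : ι ⊕ ι × A → A := Sum.elim (fun _ => a₀) Prod.snd
  let U := isometrySwap V
  have hUh : Uᴴ = U := isometrySwap_isHermitian V
  have hU : U * U = 1 := isometrySwap_mul_self hV
  have hmul (a b : A) : U * fiberProj f a * U * (U * fiberProj f b * U) =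
      U * (fiberProj f a * fiberProj f b) * U := by
    calc U * fiberProj f a * U * (U * fiberProj f b * U)
        = U * fiberProj f a * (U * U) * fiberProj f b * U := by simp only [Matrix.mul_assoc]
      _ = U * (fiberProj f a * fiberProj f b) * U := by
        rw [hU, Matrix.mul_one, Matrix.mul_assoc U]
  refine ⟨fun a => U * fiberProj f a * U, fun a => ?_, fun a => ?_, fun a b hab => ?_, ?_,
    fun a => ?_⟩
  · simpa only [hUh] using isHermitian_mul_mul_conjTranspose U (fiberProj_isHermitian f a)
  · rw [hmul, fiberProj_mul_self]
  · rw [hmul, fiberProj_mul_of_ne f hab, Matrix.mul_zero, Matrix.zero_mul]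
  · rw [← Matrix.sum_mul, ← Matrix.mul_sum, sum_fiberProj, Matrix.mul_one, hU]
  · have hblock : fiberProj f a =
        fromBlocks (fiberProj (fun _ => a₀) a) 0 0 (fiberProj Prod.snd a) := by
      rw [fiberProj, fiberProj, fiberProj, fromBlocks_diagonal]
      congr 1
      ext (i | p) <;> rfl
    simp only [hblock, U, isometrySwap, fromBlocks_multiply, toBlocks_fromBlocks₁₁]
    simpa using hcomp a

/-- `ι × Fin (m + 1)` splits as the slice over `0` and one further slice for each element of a
type equivalent to `Fin m`. -/
def prodFinSuccEquivSum (ι : Type*) {A : Type*} {m : ℕ} (e : Fin m ≃ A) :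
    ι × Fin (m + 1) ≃ ι ⊕ ι × A :=
  calc ι × Fin (m + 1)
    _ ≃ ι × (A ⊕ Unit) := (Equiv.refl ι).prodCongr
        ((finSuccEquiv m).trans (e.optionCongr.trans (Equiv.optionEquivSumPUnit A)))
    _ ≃ ι × A ⊕ ι × Unit := Equiv.prodSumDistrib ι A Unit
    _ ≃ ι × Unit ⊕ ι × A := Equiv.sumComm _ _
    _ ≃ ι ⊕ ι × A := (Equiv.prodPUnit ι).sumCongr (Equiv.refl _)

theorem prodFinSuccEquivSum_zero {ι A : Type*} {m : ℕ} (e : Fin m ≃ A) (i : ι) :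
    prodFinSuccEquivSum ι e (i, 0) = Sum.inl i := by
  simp [prodFinSuccEquivSum, Trans.trans]

/-- Naimark's dilation theorem for finite POVMs: every POVM on `ℂ^n` is the compression
of a complete projective measurement on `ℂ^n ⊗ ℂ^m` to the ancilla state `|0⟩`. -/
theorem naimark_dilation
    {n : ℕ} (hn : 1 ≤ n) {A : Type} [Fintype A] [Nonempty A]
    (N : A → Matrix (Fin n) (Fin n) ℂ)
    (hpos : ∀ a, (N a).PosSemidef)
    (hsum : ∑ a : A, N a = 1) :
    ∃ (m : ℕ) (hm : 1 ≤ m) (P : A → Matrix (Fin n × Fin m) (Fin n × Fin m) ℂ),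
      (∀ a, (P a).IsHermitian) ∧
      (∀ a, P a * P a = P a) ∧
      (∀ a a', a ≠ a' → P a * P a' = 0) ∧
      (∑ a : A, P a = 1) ∧
      (∀ (a : A) (i j : Fin n), N a i j = P a (i, ⟨0, hm⟩) (j, ⟨0, hm⟩)) := by
  classical
  obtain ⟨P, hherm, hidem, horth, hone, hcomp⟩ := naimark_dilation_sum N hpos hsum
  let e := prodFinSuccEquivSum (Fin n) (Fintype.equivFin A).symm
  refine ⟨Fintype.card A + 1, Nat.le_add_left 1 _, fun a => (P a).submatrix e e,
    fun a => (hherm a).submatrix e, fun a => ?_, fun a b hab => ?_, ?_, fun a i j => ?_⟩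
  · rw [Matrix.submatrix_mul_equiv, hidem]
  · rw [Matrix.submatrix_mul_equiv, horth a b hab, Matrix.submatrix_zero, Pi.zero_apply,
      Pi.zero_apply]
  · ext x y
    rw [← Matrix.submatrix_one_equiv e, ← hone]
    simp [Matrix.sum_apply]
  · have he (k : Fin n) : e (k, ⟨0, Nat.le_add_left 1 _⟩) = Sum.inl k :=
      prodFinSuccEquivSum_zero _ k
    change N a i j = P a (e _) (e _)
    rw [he, he, ← hcomp a]
    rfl
end

section
/- Let N ≥ 1, let A, X, B, Y be finite nonempty types, and let n, d ≥ 1. Suppose ψ : Fin n × Fin d → ℂ is a unit vector and Π : Fin N → X → A → Matrix (Fin n) (Fin n) ℂ is a family such that each Π i x a is Hermitian and idempotent and ∑_a Π i x a = 1 for all i, x. For a⃗ : Fin N → A and x⃗ : Fin N → X let P(a⃗,x⃗) := ∏_{i} Π i (x⃗ i) (a⃗ i), the product taken in the order i = 0,…,N−1, and for a permutation π of Fin N let P_π(a⃗,x⃗) be the same product taken in the order π(0),…,π(N−1). Assume the permutation-invariance condition: (P_π(a⃗,x⃗) ⊗ₖ 1) *ᵥ ψ = (P(a⃗,x⃗)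 ⊗ₖ 1) *ᵥ ψ for all π, a⃗, x⃗, and define the assemblage σ a⃗ x⃗ := ptr₁((P(a⃗,x⃗) ⊗ₖ 1) * vecMulVec ψ (star ψ)). Let Q : Y → B → Matrix (Fin d) (Fin d) ℂ be any family with each Q y b Hermitian and idempotent and ∑_b Q y b = 1. Then the (N+1)-party correlation p(a⃗, b | x⃗, y) := trace((Q y b) * (σ a⃗ x⃗)) admits an almost-quantum realisation: there exist m ≥ 1, a unit vector φ : Fin m → ℂ, families F : Fin N → X → A → Matrix (Fin m) (Fin m) ℂ and G : Y → B → Matrix (Fin m) (Fin m) ℂ of Hermitian idempotents with ∑_a F i x a = 1 and ∑_b G y b = 1, such that (i) G y b * F i x a = F i x a * G y b for all i, x, a, y, b; (ii) p(a⃗, b | x⃗, y) = star φ ⬝ᵥ ((F(a⃗,x⃗) * G y b) *ᵥ φ), where F(a⃗,x⃗) := ∏_i F i (x⃗ i) (a⃗ i) in the order i = 0,…,N−1; and (iii) for every permutation π of Fin N, (F_π(a⃗,x⃗) * G y b) *ᵥ φ = (F(a⃗,x⃗) * G y b) *ᵥ φ, where F_π is the product taken in the order π(0),…,π(N−1). 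-/
open scoped Kronecker ComplexOrder
open Matrix

/-- The ordered product `F 0 * F 1 * ⋯ * F (N-1)` of a family of matrices. -/
noncomputable def ordProd {N m : ℕ} (F : Fin N → Matrix (Fin m) (Fin m) ℂ) :
    Matrix (Fin m) (Fin m) ℂ :=
  (List.ofFn F).prod

/-- The embedding `M ↦ M ⊗ₖ 1`, with the product index set reindexed by `Fin (n * d)`. -/
noncomputable def kroneckerOneHom (n d : ℕ) :
    Matrix (Fin n) (Fin n) ℂ →+* Matrix (Fin (n * d)) (Fin (n * d)) ℂ where
  toFun M := (M ⊗ₖ (1 : Matrix (Fin d) (Fin d) ℂ)).submatrix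
    finProdFinEquiv.symm finProdFinEquiv.symm
  map_one' := by simp
  map_mul' M M' := by
    rw [Matrix.submatrix_mul_equiv, ← Matrix.mul_kronecker_mul, one_mul]
  map_zero' := by simp
  map_add' M M' := by rw [Matrix.add_kronecker, Matrix.submatrix_add, Pi.add_apply, Pi.add_apply]

/-- The embedding `M ↦ 1 ⊗ₖ M`, with the product index set reindexed by `Fin (n * d)`. -/
noncomputable def oneKroneckerHom (n d : ℕ) :
    Matrix (Fin d) (Fin d) ℂ →+* Matrix (Fin (n * d)) (Fin (n * d)) ℂ where
  toFun M := ((1 : Matrix (Fin n) (Fin n) ℂ) ⊗ₖ M).submatrix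
    finProdFinEquiv.symm finProdFinEquiv.symm
  map_one' := by simp
  map_mul' M M' := by
    rw [Matrix.submatrix_mul_equiv, ← Matrix.mul_kronecker_mul, one_mul]
  map_zero' := by simp
  map_add' M M' := by rw [Matrix.kronecker_add, Matrix.submatrix_add, Pi.add_apply, Pi.add_apply]

theorem kroneckerOneHom_apply {n d : ℕ} (M : Matrix (Fin n) (Fin n) ℂ) :
    kroneckerOneHom n d M = (M ⊗ₖ (1 : Matrix (Fin d) (Fin d) ℂ)).submatrix
      finProdFinEquiv.symm finProdFinEquiv.symm := rfl

theorem oneKroneckerHom_apply {n d : ℕ} (M : Matrix (Fin d) (Fin d) ℂ) :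
    oneKroneckerHom n d M = ((1 : Matrix (Fin n) (Fin n) ℂ) ⊗ₖ M).submatrix
      finProdFinEquiv.symm finProdFinEquiv.symm := rfl

theorem isHermitian_kroneckerOneHom {n d : ℕ} {M : Matrix (Fin n) (Fin n) ℂ}
    (hM : M.IsHermitian) : (kroneckerOneHom n d M).IsHermitian := by
  rw [kroneckerOneHom_apply]
  refine Matrix.IsHermitian.submatrix ?_ _
  rw [Matrix.IsHermitian, Matrix.conjTranspose_kronecker, hM.eq, Matrix.conjTranspose_one]

theorem isHermitian_oneKroneckerHom {n d : ℕ} {M : Matrix (Fin d) (Fin d) ℂ}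
    (hM : M.IsHermitian) : (oneKroneckerHom n d M).IsHermitian := by
  rw [oneKroneckerHom_apply]
  refine Matrix.IsHermitian.submatrix ?_ _
  rw [Matrix.IsHermitian, Matrix.conjTranspose_kronecker, hM.eq, Matrix.conjTranspose_one]

theorem oneKroneckerHom_mul_kroneckerOneHom {n d : ℕ} (M : Matrix (Fin n) (Fin n) ℂ)
    (M' : Matrix (Fin d) (Fin d) ℂ) :
    oneKroneckerHom n d M' * kroneckerOneHom n d M =
      kroneckerOneHom n d M * oneKroneckerHom n d M' := by
  simp only [kroneckerOneHom_apply, oneKroneckerHom_apply, Matrix.submatrix_mul_equiv,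
    ← Matrix.mul_kronecker_mul, one_mul, mul_one]

theorem ordProd_map {N m m' : ℕ}
    (f : Matrix (Fin m) (Fin m) ℂ →+* Matrix (Fin m') (Fin m') ℂ)
    (F : Fin N → Matrix (Fin m) (Fin m) ℂ) :
    ordProd (fun i => f (F i)) = f (ordProd F) := by
  rw [ordProd, ordProd, map_list_prod, List.map_ofFn]
  rfl

theorem submatrix_symm_mulVec_comp_symm {ι κ : Type*} [Fintype ι] [Fintype κ] (e : ι ≃ κ)
    (M : Matrix ι ι ℂ) (v : ι → ℂ) :
    M.submatrix e.symm e.symm *ᵥ (v ∘ e.symm) = (M *ᵥ v) ∘ e.symm := by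
  rw [Matrix.submatrix_mulVec_equiv, Function.comp_assoc]
  simp

theorem star_comp_symm_dotProduct_comp_symm {ι κ : Type*} [Fintype ι] [Fintype κ] (e : ι ≃ κ)
    (v w : ι → ℂ) : star (v ∘ e.symm) ⬝ᵥ (w ∘ e.symm) = star v ⬝ᵥ w :=
  e.symm.sum_comp fun i => star (v i) * w i

/-- The defining adjunction of the partial trace, for a rank-one operator. -/
theorem trace_mul_ptr1_vecMulVec {n d : ℕ} (M : Matrix (Fin d) (Fin d) ℂ)
    (v w : Fin n × Fin d → ℂ) :
    (M * ptr1 (Matrix.vecMulVec v (star w))).trace =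
      star w ⬝ᵥ (((1 : Matrix (Fin n) (Fin n) ℂ) ⊗ₖ M) *ᵥ v) := by
  have hcol (k : Fin n) (i : Fin d) :
      (((1 : Matrix (Fin n) (Fin n) ℂ) ⊗ₖ M) *ᵥ v) (k, i) = ∑ j, M i j * v (k, j) := by
    simp [Matrix.mulVec, dotProduct, Fintype.sum_prod_type, Matrix.one_apply]
  simp only [dotProduct, Fintype.sum_prod_type, hcol, Matrix.trace, Matrix.diag_apply,
    Matrix.mul_apply, ptr1, Matrix.of_apply, Matrix.vecMulVec_apply, Finset.mul_sum]
  rw [Finset.sum_comm (γ := Fin n)]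
  refine Finset.sum_congr rfl fun i _ => ?_
  rw [Finset.sum_comm]
  refine Finset.sum_congr rfl fun k _ => Finset.sum_congr rfl fun j _ => ?_
  ring

/-- Proposition 1: almost-quantum assemblages satisfy macroscopic non-contextuality;
every correlation obtained by measuring projective measurements on an almost-quantum
assemblage is an almost-quantum correlation. -/
theorem almost_quantum_assemblage_gives_almost_quantum_correlations
    {N : ℕ} (hN : 1 ≤ N)
    {A X B Y : Type} [Fintype A] [Nonempty A] [Fintype X] [Nonempty X]
    [Fintype B] [Nonempty B] [Fintype Y] [Nonempty Y]
    {n d : ℕ} (hn : 1 ≤ n) (hd : 1 ≤ d)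
    (ψ : Fin n × Fin d → ℂ) (hψ : star ψ ⬝ᵥ ψ = 1)
    (Pj : Fin N → X → A → Matrix (Fin n) (Fin n) ℂ)
    (hPherm : ∀ i x a, (Pj i x a).IsHermitian)
    (hPidem : ∀ i x a, Pj i x a * Pj i x a = Pj i x a)
    (hPsum : ∀ i x, ∑ a : A, Pj i x a = 1)
    (hperm : ∀ (π : Equiv.Perm (Fin N)) (av : Fin N → A) (xv : Fin N → X),
      ((ordProd (fun j => Pj (π j) (xv (π j)) (av (π j))) ⊗ₖ
          (1 : Matrix (Fin d) (Fin d) ℂ)) *ᵥ ψ) =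
        ((ordProd (fun i => Pj i (xv i) (av i)) ⊗ₖ
          (1 : Matrix (Fin d) (Fin d) ℂ)) *ᵥ ψ))
    (σ : (Fin N → A) → (Fin N → X) → Matrix (Fin d) (Fin d) ℂ)
    (hσ : ∀ av xv, σ av xv =
      ptr1 ((ordProd (fun i => Pj i (xv i) (av i)) ⊗ₖ (1 : Matrix (Fin d) (Fin d) ℂ)) *
        Matrix.vecMulVec ψ (star ψ)))
    (Q : Y → B → Matrix (Fin d) (Fin d) ℂ)
    (hQherm : ∀ y b, (Q y b).IsHermitian)
    (hQidem : ∀ y b, Q y b * Q y b = Q y b)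
    (hQsum : ∀ y, ∑ b : B, Q y b = 1) :
    ∃ (m : ℕ), 1 ≤ m ∧
    ∃ (φ : Fin m → ℂ), star φ ⬝ᵥ φ = 1 ∧
    ∃ (F : Fin N → X → A → Matrix (Fin m) (Fin m) ℂ)
      (G : Y → B → Matrix (Fin m) (Fin m) ℂ),
      (∀ i x a, (F i x a).IsHermitian) ∧
      (∀ i x a, F i x a * F i x a = F i x a) ∧
      (∀ i x, ∑ a : A, F i x a = 1) ∧
      (∀ y b, (G y b).IsHermitian) ∧
      (∀ y b, G y b * G y b = G y b) ∧
      (∀ y, ∑ b : B, G y b = 1) ∧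
      (∀ i x a y b, G y b * F i x a = F i x a * G y b) ∧
      (∀ (av : Fin N → A) (xv : Fin N → X) (y : Y) (b : B),
        ((Q y b) * (σ av xv)).trace =
          star φ ⬝ᵥ ((ordProd (fun i => F i (xv i) (av i)) * G y b) *ᵥ φ)) ∧
      (∀ (π : Equiv.Perm (Fin N)) (av : Fin N → A) (xv : Fin N → X) (y : Y) (b : B),
        (ordProd (fun j => F (π j) (xv (π j)) (av (π j))) * G y b) *ᵥ φ =
          (ordProd (fun i => F i (xv i) (av i)) * G y b) *ᵥ φ) := by
  have hcomm (M : Matrix (Fin n) (Fin n) ℂ) (M' : Matrix (Fin d) (Fin d) ℂ) :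
      (kroneckerOneHom n d M * oneKroneckerHom n d M') *ᵥ (ψ ∘ finProdFinEquiv.symm) =
        (((1 : Matrix (Fin n) (Fin n) ℂ) ⊗ₖ M') *ᵥ
          ((M ⊗ₖ (1 : Matrix (Fin d) (Fin d) ℂ)) *ᵥ ψ)) ∘ finProdFinEquiv.symm := by
    rw [← oneKroneckerHom_mul_kroneckerOneHom, ← Matrix.mulVec_mulVec, kroneckerOneHom_apply,
      oneKroneckerHom_apply, submatrix_symm_mulVec_comp_symm, submatrix_symm_mulVec_comp_symm]
  refine ⟨n * d, Nat.mul_pos hn hd, ψ ∘ finProdFinEquiv.symm, ?_,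
    fun i x a => kroneckerOneHom n d (Pj i x a), fun y b => oneKroneckerHom n d (Q y b),
    fun i x a => isHermitian_kroneckerOneHom (hPherm i x a), fun i x a => ?_, fun i x => ?_,
    fun y b => isHermitian_oneKroneckerHom (hQherm y b), fun y b => ?_, fun y => ?_,
    fun i x a y b => oneKroneckerHom_mul_kroneckerOneHom _ _,
    fun av xv y b => ?_, fun π av xv y b => ?_⟩
  · rw [star_comp_symm_dotProduct_comp_symm, hψ]
  · rw [← map_mul, hPidem]
  · rw [← map_sum, hPsum, map_one]
  · rw [← map_mul, hQidem]
  · rw [← map_sum, hQsum, map_one]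
  · rw [hσ, Matrix.mul_vecMulVec, trace_mul_ptr1_vecMulVec, ordProd_map, hcomm,
      star_comp_symm_dotProduct_comp_symm]
  · rw [ordProd_map, ordProd_map, hcomm, hcomm, hperm]
end
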